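/- arXiv:1808.03950 — 7 statements merged into one kernel-verified Lean document; each statement's English description precedes it below -/
import Mathlib

section
/- Let n be a positive integer and let P and X be n×n real matrices. Then X satisfies the matrix equation (I − P)X = J − P·X_d if and only if for every index i the i-th column x_i of X satisfies the linear system A_i x_i = e, where A_i = I − P_i. -/
/-- `X` satisfies `(I - P) X = J - P * X_d` iff for every index `i`
the `i`-th column of `X` solves `A_i x = e`, where `A_i = I - P_i` and `P_i` is
`P` with column `i` replaced by zeros. -/
theorem stmt_0 (n : ℕ) (hn : 0 < n) (P X : Matrix (Fin n) (Fin n) ℝ) :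
    (1 - P) * X =
        (Matrix.of fun _ _ => (1 : ℝ)) - P * Matrix.diagonal (fun i => X i i) ↔
      ∀ i : Fin n,
        (1 - Matrix.of fun a b => if b = i then 0 else P a b).mulVec (fun j => X j i) =
          fun _ => (1 : ℝ) := by
  have key (a i : Fin n) :
      ((Matrix.of fun a b => if b = i then 0 else P a b).mulVec fun j => X j i) a =
        (P * X) a i - P a i * X i i := by
    simp only [Matrix.mulVec, dotProduct, Matrix.of_apply, Matrix.mul_apply, ite_mul, zero_mul]
    rw [eq_sub_iff_add_eq, ← Finset.sum_erase_add _ (fun b => P a b * X b i) (Finset.mem_univ i),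
      ← Finset.sum_erase_add _ _ (Finset.mem_univ i), if_pos rfl, add_zero]
    congr 1
    exact Finset.sum_congr rfl fun b hb => if_neg (Finset.ne_of_mem_erase hb)
  simp only [← Matrix.ext_iff, funext_iff, Matrix.sub_mulVec, Matrix.one_mulVec, Pi.sub_apply,
    key, Matrix.sub_mul, Matrix.one_mul, Matrix.sub_apply, Matrix.mul_diagonal, Matrix.of_apply]
  rw [forall_comm]
  refine forall_congr' fun i => forall_congr' fun a => ?_
  constructor <;> intro h <;> linarith
end

section
/- Let n be a positive integer and P an n×n real matrix. If for every index i the vector x_i is a solution of the linear system (I − P_i)·x_i = e, then the matrix X whose i-th column is x_i satisfies the matrix equation (I − P)X = J − P·X_d. -/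
/-- If for every `i` the vector `x i` solves `(I - P_i) · (x i) = e`, then the
matrix `X` whose `i`-th column is `x i` satisfies `(I - P) X = J - P * X_d`. -/
theorem stmt_2 (n : ℕ) (hn : 0 < n) (P : Matrix (Fin n) (Fin n) ℝ) (x : Fin n → Fin n → ℝ)
    (h : ∀ i : Fin n,
        (1 - Matrix.of fun a b => if b = i then 0 else P a b).mulVec (x i) =
          fun _ => (1 : ℝ)) :
    (1 - P) * (Matrix.of fun a b => x b a) =
      (Matrix.of fun _ _ => (1 : ℝ)) -
        P * Matrix.diagonal (fun i => (Matrix.of fun a b => x b a) i i) := by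
  ext a i
  have hi := congrFun (h i) a
  have hsum : ∑ b, (if b = i then 0 else P a b) * x i b =
      ∑ b, P a b * x i b - P a i * x i i := by
    rw [eq_sub_iff_add_eq, ← Finset.sum_erase_add _ _ (Finset.mem_univ i),
      ← Finset.sum_erase_add _ (fun b => P a b * x i b) (Finset.mem_univ i)]
    simp only [if_true, zero_mul, add_zero]
    congr 1
    refine Finset.sum_congr rfl fun b hb => ?_
    rw [if_neg (Finset.ne_of_mem_erase hb)]
  rw [Matrix.sub_mulVec, Matrix.one_mulVec, Pi.sub_apply] at hi
  simp only [Matrix.mulVec, dotProduct, Matrix.of_apply] at hi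
  rw [hsum] at hi
  rw [Matrix.sub_mul, Matrix.one_mul, Matrix.sub_apply, Matrix.sub_apply,
    Matrix.mul_diagonal, Matrix.mul_apply]
  simp only [Matrix.of_apply]
  linarith
end

section
/- Let n be a positive integer and let P be an n×n row-stochastic matrix that is regular, i.e., there exists a positive integer k such that every entry of P^k is strictly positive. Then for every index i the matrix A_i = I − P_i is invertible. -/
namespace Matrix

variable {ι : Type*} [Fintype ι]

/-- A subinvariant vector of a nonnegative matrix is subinvariant for all of its powers. -/
lemma le_pow_mulVec_of_le_mulVec [DecidableEq ι] {P : Matrix ι ι ℝ} (hP : ∀ a b, 0 ≤ P a b) {u : ι → ℝ}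
    (hu : u ≤ P *ᵥ u) (k : ℕ) : u ≤ P ^ k *ᵥ u := by
  induction k with
  | zero => simp
  | succ k ih =>
    rw [pow_succ', ← mulVec_mulVec]
    exact hu.trans fun a => Finset.sum_le_sum fun b _ => mul_le_mul_of_nonneg_left (ih b) (hP a b)

/-- A subinvariant vector of a positive row-stochastic matrix which vanishes somewhere is
nonpositive. -/
lemma nonpos_of_le_mulVec {Q : Matrix ι ι ℝ} (hQ : ∀ a b, 0 < Q a b) (hrow : ∀ a, ∑ b, Q a b = 1)
    {u : ι → ℝ} (hu : u ≤ Q *ᵥ u) {i : ι} (hi : u i = 0) : u ≤ 0 := by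
  have : Nonempty ι := ⟨i⟩
  obtain ⟨m, hm⟩ := Finite.exists_max u
  have hsum : ∑ b, Q m b * (u m - u b) ≤ 0 := by
    have h := hu m
    simp only [mulVec, dotProduct] at h
    simp only [mul_sub, Finset.sum_sub_distrib, ← Finset.sum_mul, hrow]
    linarith
  have hle : Q m i * (u m - u i) ≤ ∑ b, Q m b * (u m - u b) :=
    Finset.single_le_sum (f := fun b => Q m b * (u m - u b))
      (fun b _ => mul_nonneg (hQ m b).le (sub_nonneg.2 (hm b))) (Finset.mem_univ i)
  have hum : u m ≤ 0 := by
    rw [hi, sub_zero] at hle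
    exact nonpos_of_mul_nonpos_right (hle.trans hsum) (hQ m i)
  exact fun a => (hm a).trans hum

end Matrix

open Matrix in
/-- If `P` is row-stochastic and regular (some power has all entries positive),
then for every index `i` the matrix `A_i = I - P_i` is invertible. -/
theorem stmt_3 (n : ℕ) (hn : 0 < n) (P : Matrix (Fin n) (Fin n) ℝ)
    (hnonneg : ∀ a b, 0 ≤ P a b) (hrow : ∀ a, ∑ b, P a b = 1)
    (hreg : ∃ k : ℕ, 0 < k ∧ ∀ a b, 0 < (P ^ k) a b) :
    ∀ i : Fin n, IsUnit (1 - Matrix.of fun a b => if b = i then 0 else P a b) := by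
  intro i
  obtain ⟨k, -, hk⟩ := hreg
  rw [isUnit_iff_isUnit_det, isUnit_iff_ne_zero, Ne, ← exists_mulVec_eq_zero_iff]
  rintro ⟨v, hv, hker⟩
  rw [sub_mulVec, one_mulVec, sub_eq_zero] at hker
  set u : Fin n → ℝ := fun b => if b = i then 0 else |v b| with hu
  have habs : ∀ a, |v a| ≤ (P *ᵥ u) a := fun a => by
    rw [congrFun hker a]
    simp only [mulVec, dotProduct]
    refine (Finset.abs_sum_le_sum_abs _ _).trans (Finset.sum_le_sum fun b _ => ?_)
    by_cases hb : b = i <;> simp [hu, hb, abs_mul, abs_of_nonneg (hnonneg a b)]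
  have hsub : u ≤ P *ᵥ u := fun a => by
    refine le_trans ?_ (habs a)
    by_cases ha : a = i <;> simp [hu, ha]
  have hrowk : ∀ a, ∑ b, (P ^ k) a b = 1 :=
    (mem_rowStochastic_iff_sum.1
      (pow_mem (mem_rowStochastic_iff_sum.2 ⟨hnonneg, hrow⟩) k)).2
  have hu0 : u ≤ 0 :=
    nonpos_of_le_mulVec hk hrowk (le_pow_mulVec_of_le_mulVec hnonneg hsub k) (i := i) (by simp [hu])
  refine hv (funext fun a => abs_nonpos_iff.1 ((habs a).trans ?_))
  simp only [mulVec, dotProduct]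
  exact Finset.sum_nonpos fun b _ => mul_nonpos_of_nonneg_of_nonpos (hnonneg a b) (hu0 b)
end

section
/- Let n be a positive integer and let P be an n×n row-stochastic matrix that is regular, i.e., there exists a positive integer k such that every entry of P^k is strictly positive. Then for every index i the linear system (I − P_i)·x = e is compatible, i.e., there exists a real n-vector x with (I − P_i)·x = e. -/
/-- A fixed vector of a regular stochastic matrix with one column replaced by zero vanishes. -/
theorem eq_zero_of_fixed_zero_column {ι : Type*} [Fintype ι] [DecidableEq ι]
    (P : Matrix ι ι ℝ) (hnonneg : ∀ a b, 0 ≤ P a b) (hrow : ∀ a, ∑ b, P a b = 1)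
    (hreg : ∃ k : ℕ, 0 < k ∧ ∀ a b, 0 < (P ^ k) a b) (i : ι) (x : ι → ℝ)
    (hx : ∀ a, ∑ b, (if b = i then 0 else P a b) * x b = x a) : x = 0 := by
  have : Nonempty ι := ⟨i⟩
  obtain ⟨c, hc⟩ := Finite.exists_max fun a => |x a|
  by_contra hne
  have hpos : 0 < |x c| := by
    obtain ⟨a, ha⟩ := Function.ne_iff.mp hne
    exact (abs_pos.mpr ha).trans_le (hc a)
  have hterm : ∀ a, |x a| = |x c| → ∀ b,
      P a b * (|x c| - if b = i then 0 else |x b|) = 0 := by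
    intro a ha b
    have hnn : ∀ b ∈ Finset.univ, 0 ≤ P a b * (|x c| - if b = i then 0 else |x b|) := by
      intro b _
      refine mul_nonneg (hnonneg a b) ?_
      split_ifs
      · simp
      · exact sub_nonneg.mpr (hc b)
    have hle : |x a| ≤ ∑ b, P a b * (if b = i then 0 else |x b|) := by
      rw [← hx a]
      refine (Finset.abs_sum_le_sum_abs _ _).trans (Finset.sum_le_sum fun b _ => ?_)
      split_ifs
      · simp
      · rw [abs_mul, abs_of_nonneg (hnonneg a b)]
    have hsum : ∑ b, P a b * (|x c| - if b = i then 0 else |x b|) ≤ 0 := by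
      simp only [mul_sub, Finset.sum_sub_distrib, ← Finset.sum_mul, hrow, one_mul]
      linarith
    exact (Finset.sum_eq_zero_iff_of_nonneg hnn).mp
      (le_antisymm hsum (Finset.sum_nonneg hnn)) b (Finset.mem_univ b)
  have hpow : ∀ k : ℕ, ∀ a, |x a| = |x c| → (P ^ (k + 1)) a i = 0 := by
    intro k
    induction k with
    | zero =>
      intro a ha
      simpa [hpos.ne'] using hterm a ha i
    | succ k ih =>
      intro a ha
      rw [pow_succ', Matrix.mul_apply]
      refine Finset.sum_eq_zero fun b _ => ?_
      rcases mul_eq_zero.mp (hterm a ha b) with h | h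
      · rw [h, zero_mul]
      · split_ifs at h
        · exact absurd (by simpa using h) hpos.ne'
        · rw [ih b (sub_eq_zero.mp h).symm, mul_zero]
  obtain ⟨k, hk, hP⟩ := hreg
  obtain ⟨j, rfl⟩ := Nat.exists_eq_succ_of_ne_zero hk.ne'
  exact (hP c i).ne' (hpow j c rfl)


/-- If `P` is row-stochastic and regular, then for every index `i` the linear
system `(I - P_i) x = e` has a solution. -/
theorem stmt_4 (n : ℕ) (hn : 0 < n) (P : Matrix (Fin n) (Fin n) ℝ)
    (hnonneg : ∀ a b, 0 ≤ P a b) (hrow : ∀ a, ∑ b, P a b = 1)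
    (hreg : ∃ k : ℕ, 0 < k ∧ ∀ a b, 0 < (P ^ k) a b) :
    ∀ i : Fin n, ∃ x : Fin n → ℝ,
      (1 - Matrix.of fun a b => if b = i then 0 else P a b).mulVec x =
        fun _ => (1 : ℝ) := by
  intro i
  refine (Matrix.mulVec_surjective_iff_isUnit.mpr
    (Matrix.mulVec_injective_iff_isUnit.mp ?_)) _
  refine (injective_iff_map_eq_zero (Matrix.mulVecLin
    (1 - Matrix.of fun a b => if b = i then 0 else P a b))).mpr fun x hx => ?_
  refine eq_zero_of_fixed_zero_column P hnonneg hrow hreg i x fun a => ?_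
  rw [Matrix.mulVecLin_apply, Matrix.sub_mulVec, Matrix.one_mulVec, sub_eq_zero] at hx
  exact (congrFun hx a).symm
end

section
/- Let n be a positive integer and let P be an n×n row-stochastic matrix that is regular, i.e., there exists a positive integer k such that every entry of P^k is strictly positive. Then the matrix equation (I − P)X = J − P·X_d has exactly one solution X among n×n real matrices. -/
/-- A vector fixed by a regular stochastic matrix with its `j`-th column removed vanishes. -/
theorem eq_zero_of_eq_mulVec_update {ι : Type*} [Fintype ι] [DecidableEq ι] {P : Matrix ι ι ℝ}
    (hnonneg : ∀ a b, 0 ≤ P a b) (hrow : ∀ a, ∑ b, P a b = 1)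
    {k : ℕ} (hk : 0 < k) (hpos : ∀ a b, 0 < (P ^ k) a b)
    (j : ι) (x : ι → ℝ) (hx : ∀ a, x a = ∑ b, P a b * Function.update x j 0 b) : x = 0 := by
  have hne : Nonempty ι := ⟨j⟩
  obtain ⟨i, hi⟩ := Finite.exists_max fun a => |x a|
  by_contra hx0
  have hM : 0 < |x i| := by
    obtain ⟨a, ha⟩ := Function.ne_iff.mp hx0
    exact (abs_pos.mpr ha).trans_le (hi a)
  have hz : ∀ b, |Function.update x j 0 b| ≤ |x i| := by
    intro b
    rcases eq_or_ne b j with rfl | hb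
    · simp
    · simpa [hb] using hi b
  have hstep : ∀ a, |x a| = |x i| → ∀ b, P a b = 0 ∨ |Function.update x j 0 b| = |x i| := by
    intro a ha b
    have hterm : ∀ c ∈ Finset.univ, 0 ≤ P a c * (|x i| - |Function.update x j 0 c|) :=
      fun c _ => mul_nonneg (hnonneg a c) (sub_nonneg.mpr (hz c))
    have hle : |x a| ≤ ∑ c, P a c * |Function.update x j 0 c| := by
      conv_lhs => rw [hx a]
      refine (Finset.abs_sum_le_sum_abs _ _).trans_eq (Finset.sum_congr rfl fun c _ => ?_)
      rw [abs_mul, abs_of_nonneg (hnonneg a c)]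
    have hsum : ∑ c, P a c * (|x i| - |Function.update x j 0 c|) = 0 := by
      refine le_antisymm ?_ (Finset.sum_nonneg hterm)
      simp only [mul_sub, Finset.sum_sub_distrib, ← Finset.sum_mul, hrow]
      linarith
    have h := (Finset.sum_eq_zero_iff_of_nonneg hterm).mp hsum b (Finset.mem_univ b)
    exact (mul_eq_zero.mp h).imp_right fun h => (sub_eq_zero.mp h).symm
  have hpow : ∀ m a, |x a| = |x i| → (P ^ (m + 1)) a j = 0 := by
    intro m
    induction m with
    | zero =>
      intro a ha
      rcases hstep a ha j with h | h
      · simpa using h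
      · simp only [Function.update_self, abs_zero] at h
        exact absurd h hM.ne
    | succ m ih =>
      intro a ha
      rw [pow_succ', Matrix.mul_apply]
      refine Finset.sum_eq_zero fun b _ => ?_
      rcases hstep a ha b with h | h
      · rw [h, zero_mul]
      · rcases eq_or_ne b j with rfl | hb
        · simp only [Function.update_self, abs_zero] at h
          exact absurd h hM.ne
        · rw [Function.update_of_ne hb] at h
          rw [ih b h, mul_zero]
  obtain ⟨m, rfl⟩ := Nat.exists_eq_succ_of_ne_zero hk.ne'
  exact (hpos i j).ne' (hpow m i rfl)

/-- The linear map `X ↦ (1 - P) * X + P * X_d`. -/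
def oneSubMulAddMulDiag {ι : Type*} [Fintype ι] [DecidableEq ι] (P : Matrix ι ι ℝ) :
    Matrix ι ι ℝ →ₗ[ℝ] Matrix ι ι ℝ :=
  LinearMap.mulLeft ℝ (1 - P) +
    LinearMap.mulLeft ℝ P ∘ₗ Matrix.diagonalLinearMap ι ℝ ℝ ∘ₗ Matrix.diagLinearMap ι ℝ ℝ

theorem oneSubMulAddMulDiag_apply {ι : Type*} [Fintype ι] [DecidableEq ι] (P X : Matrix ι ι ℝ) :
    oneSubMulAddMulDiag P X = (1 - P) * X + P * Matrix.diagonal (fun i => X i i) :=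
  rfl

theorem oneSubMulAddMulDiag_injective {ι : Type*} [Fintype ι] [DecidableEq ι] {P : Matrix ι ι ℝ}
    (hnonneg : ∀ a b, 0 ≤ P a b) (hrow : ∀ a, ∑ b, P a b = 1)
    {k : ℕ} (hk : 0 < k) (hpos : ∀ a b, 0 < (P ^ k) a b) :
    Function.Injective (oneSubMulAddMulDiag P) := by
  rw [injective_iff_map_eq_zero]
  intro X hX
  rw [oneSubMulAddMulDiag_apply] at hX
  ext a j
  refine congrFun (eq_zero_of_eq_mulVec_update hnonneg hrow hk hpos j (fun b => X b j) ?_) a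
  intro c
  have h := congrFun (congrFun hX c) j
  rw [sub_mul, one_mul, Matrix.add_apply, Matrix.sub_apply, Matrix.mul_diagonal,
    Matrix.mul_apply, Matrix.zero_apply] at h
  have hupd : ∀ b, P c b * Function.update (fun b => X b j) j 0 b =
      P c b * X b j - if b = j then P c b * X b j else 0 := by
    intro b
    rcases eq_or_ne b j with rfl | hb <;> simp [*]
  simp only [hupd, Finset.sum_sub_distrib, Finset.sum_ite_eq', Finset.mem_univ, if_true]
  linarith

/-- If `P` is row-stochastic and regular, the matrix equation
`(I - P) X = J - P * X_d` has exactly one solution `X`. -/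
theorem stmt_5 (n : ℕ) (hn : 0 < n) (P : Matrix (Fin n) (Fin n) ℝ)
    (hnonneg : ∀ a b, 0 ≤ P a b) (hrow : ∀ a, ∑ b, P a b = 1)
    (hreg : ∃ k : ℕ, 0 < k ∧ ∀ a b, 0 < (P ^ k) a b) :
    ∃! X : Matrix (Fin n) (Fin n) ℝ,
      (1 - P) * X =
        (Matrix.of fun _ _ => (1 : ℝ)) - P * Matrix.diagonal (fun i => X i i) := by
  obtain ⟨k, hk, hpos⟩ := hreg
  have hinj := oneSubMulAddMulDiag_injective hnonneg hrow hk hpos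
  have hbij : Function.Bijective (oneSubMulAddMulDiag P) :=
    ⟨hinj, LinearMap.injective_iff_surjective.mp hinj⟩
  simpa only [oneSubMulAddMulDiag_apply, ← eq_sub_iff_add_eq] using
    hbij.existsUnique (Matrix.of fun _ _ => (1 : ℝ))
end

section
/- Let n be a positive integer and let P be an n×n row-stochastic matrix that is regular, i.e., there exists a positive integer k such that every entry of P^k is strictly positive. Then the matrix X whose i-th column is (I − P_i)⁻¹·e (for each index i) satisfies the matrix equation (I − P)X = J − P·X_d. -/
open Matrix in
/-- A subharmonic vector of a regular row-stochastic matrix is constant. -/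
lemma eq_of_le_mulVec_of_regular {ι : Type*} [Fintype ι] [DecidableEq ι] {P : Matrix ι ι ℝ}
    (hnonneg : ∀ a b, 0 ≤ P a b) (hrow : ∀ a, ∑ b, P a b = 1) {k : ℕ}
    (hk : ∀ a b, 0 < (P ^ k) a b) {u : ι → ℝ} (hu : ∀ a, u a ≤ (P *ᵥ u) a)
    {a : ι} (ha : ∀ b, u b ≤ u a) (b : ι) : u b = u a := by
  have hpow : ∀ m : ℕ, (∀ c, u c ≤ ((P ^ m) *ᵥ u) c) ∧ ∀ c, ∑ d, (P ^ m) c d = 1 := by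
    intro m
    induction m with
    | zero => simp [Matrix.one_apply]
    | succ m ih =>
      refine ⟨fun c => (hu c).trans ?_, fun c => ?_⟩
      · rw [pow_succ', ← mulVec_mulVec]
        exact Finset.sum_le_sum fun d _ => mul_le_mul_of_nonneg_left (ih.1 d) (hnonneg c d)
      · simp only [pow_succ', Matrix.mul_apply]
        rw [Finset.sum_comm]
        simp only [← Finset.mul_sum, ih.2, mul_one, hrow]
  have hterm : ∀ c ∈ Finset.univ, 0 ≤ (P ^ k) a c * (u a - u c) := fun c _ =>
    mul_nonneg (hk a c).le (sub_nonneg.2 (ha c))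
  have hsum : ∑ c, (P ^ k) a c * (u a - u c) = 0 := by
    refine le_antisymm ?_ (Finset.sum_nonneg hterm)
    simp only [mul_sub, Finset.sum_sub_distrib, ← Finset.sum_mul, (hpow k).2, one_mul]
    exact sub_nonpos.2 ((hpow k).1 a)
  have hb := (Finset.sum_eq_zero_iff_of_nonneg hterm).1 hsum b (Finset.mem_univ b)
  linarith [(mul_eq_zero.1 hb).resolve_left (hk a b).ne']

open Matrix in
/-- Replacing a column of a regular row-stochastic matrix `P` by zero makes `1 - P` invertible. -/
lemma isUnit_one_sub_zero_column_of_regular {ι : Type*} [Fintype ι] [DecidableEq ι]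
    {P : Matrix ι ι ℝ} (hnonneg : ∀ a b, 0 ≤ P a b) (hrow : ∀ a, ∑ b, P a b = 1)
    (hreg : ∃ k : ℕ, 0 < k ∧ ∀ a b, 0 < (P ^ k) a b) (i : ι) :
    IsUnit (1 - Matrix.of fun c b => if b = i then 0 else P c b) := by
  obtain ⟨k, hk0, hk⟩ := hreg
  rw [← mulVec_injective_iff_isUnit]
  refine (injective_iff_map_eq_zero (mulVecLin _)).2 fun v hv => ?_
  rw [mulVecLin_apply, sub_mulVec, one_mulVec, sub_eq_zero] at hv
  have hle : ∀ c, |v c| ≤ ∑ b, P c b * |v b| - P c i * |v i| := by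
    intro c
    have hsplit : ∑ b, P c b * |v b| - P c i * |v i|
        = ∑ b, (if b = i then 0 else P c b) * |v b| := by
      rw [sub_eq_iff_eq_add, ← Finset.sum_erase_add _ _ (Finset.mem_univ i),
        ← Finset.sum_erase_add (a := i) _ (fun b => (if b = i then 0 else P c b) * |v b|)
          (Finset.mem_univ i)]
      simp only [if_true, zero_mul, add_zero, add_left_inj]
      exact Finset.sum_congr rfl fun b hb => by rw [if_neg (Finset.ne_of_mem_erase hb)]
    rw [hsplit]
    conv_lhs => rw [hv]
    refine (Finset.abs_sum_le_sum_abs _ _).trans_eq (Finset.sum_congr rfl fun b _ => ?_)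
    have hent : 0 ≤ if b = i then 0 else P c b := by
      split_ifs
      exacts [le_rfl, hnonneg c b]
    exact (abs_mul _ _).trans (congrArg (· * |v b|) (abs_of_nonneg hent))
  obtain ⟨a, -, ha⟩ := Finset.exists_max_image Finset.univ (fun b => |v b|) ⟨i, Finset.mem_univ i⟩
  have hconst : ∀ b, |v b| = |v a| := eq_of_le_mulVec_of_regular hnonneg hrow hk
    (u := fun b => |v b|)
    (fun c => (hle c).trans (sub_le_self _ (mul_nonneg (hnonneg c i) (abs_nonneg _))))
    (fun b => ha b (Finset.mem_univ b))
  by_contra hne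
  have hpos : 0 < |v a| := by
    refine (abs_nonneg _).lt_of_ne fun h => hne (funext fun b => ?_)
    exact abs_eq_zero.1 ((hconst b).trans h.symm)
  have hcol : ∀ c, P c i = 0 := by
    intro c
    have hc := hle c
    simp only [hconst, ← Finset.sum_mul, hrow] at hc
    refine le_antisymm ?_ (hnonneg c i)
    by_contra! h
    linarith [mul_pos h hpos]
  obtain ⟨j, rfl⟩ := Nat.exists_eq_succ_of_ne_zero hk0.ne'
  have hii := hk i i
  simp [pow_succ, Matrix.mul_apply, hcol] at hii


/-- If `P` is row-stochastic and regular, then the matrix `X` whose `i`-th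
column is `(I - P_i)⁻¹ e` satisfies `(I - P) X = J - P * X_d`. -/
theorem stmt_6 (n : ℕ) (hn : 0 < n) (P : Matrix (Fin n) (Fin n) ℝ)
    (hnonneg : ∀ a b, 0 ≤ P a b) (hrow : ∀ a, ∑ b, P a b = 1)
    (hreg : ∃ k : ℕ, 0 < k ∧ ∀ a b, 0 < (P ^ k) a b) :
    let X : Matrix (Fin n) (Fin n) ℝ :=
      Matrix.of fun a i =>
        ((1 - Matrix.of fun c b => if b = i then 0 else P c b)⁻¹).mulVec
          (fun _ => (1 : ℝ)) a
    (1 - P) * X =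
      (Matrix.of fun _ _ => (1 : ℝ)) - P * Matrix.diagonal (fun i => X i i) := by
  intro X
  ext a i
  have hunit := isUnit_one_sub_zero_column_of_regular hnonneg hrow hreg i
  have hcol : (1 - Matrix.of fun c b => if b = i then 0 else P c b).mulVec (fun b => X b i)
      = fun _ => 1 := by
    rw [show (fun b => X b i) =
        ((1 - Matrix.of fun c b => if b = i then 0 else P c b)⁻¹).mulVec (fun _ => (1 : ℝ)) from rfl,
      Matrix.mulVec_mulVec, Matrix.mul_nonsing_inv _ ((Matrix.isUnit_iff_isUnit_det _).1 hunit),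
      Matrix.one_mulVec]
  have ha := congrFun hcol a
  rw [Matrix.sub_mulVec, Matrix.one_mulVec, Pi.sub_apply] at ha
  have hsplit : ∑ b, P a b * X b i
      = (Matrix.of fun c b => if b = i then 0 else P c b).mulVec (fun b => X b i) a
        + P a i * X i i := by
    simp only [Matrix.mulVec, dotProduct, Matrix.of_apply]
    rw [← sub_eq_iff_eq_add', ← Finset.sum_sub_distrib, Finset.sum_eq_single i]
    · simp
    · intro b _ hb
      simp [hb]
    · simp
  rw [Matrix.sub_mul, Matrix.one_mul, Matrix.sub_apply, Matrix.sub_apply, Matrix.mul_diagonal,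
    Matrix.mul_apply, hsplit, Matrix.of_apply]
  linarith
end

section
/- Let n be a positive integer and let P be an n×n row-stochastic matrix that is regular, i.e., there exists a positive integer k such that every entry of P^k is strictly positive. Suppose X is a solution of the matrix equation (I − P)X = J − P·X_d. Then for every index i, the i-th column x_i of X is the minimal-norm solution of the system (I − P_i)·x = e: it satisfies (I − P_i)·x_i = e, and for every real n-vector y with (I − P_i)·y = e one has ∑_k (x_i)_k² ≤ ∑_k y_k². -/
/-- A regular row-stochastic matrix with one column deleted has no nonzero fixed vector. -/
theorem eq_zero_of_eq_sum_deleted_column {ι : Type*} [Fintype ι] [DecidableEq ι]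
    (P : Matrix ι ι ℝ) (hnonneg : ∀ a b, 0 ≤ P a b) (hrow : ∀ a, ∑ b, P a b = 1)
    (hreg : ∃ k : ℕ, 0 < k ∧ ∀ a b, 0 < (P ^ k) a b) (i : ι) (z : ι → ℝ)
    (hz : ∀ a, z a = ∑ b, (if b = i then 0 else P a b) * z b) : z = 0 := by
  obtain ⟨k, hk, hpos⟩ := hreg
  have hsub : ∀ a, |z a| ≤ ∑ b, (if b = i then 0 else P a b) * |z b| := by
    intro a
    calc |z a| = |∑ b, (if b = i then 0 else P a b) * z b| := by rw [← hz a]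
      _ ≤ ∑ b, |(if b = i then 0 else P a b) * z b| := Finset.abs_sum_le_sum_abs _ _
      _ = _ := by
        refine Finset.sum_congr rfl fun b _ => ?_
        rw [abs_mul, abs_of_nonneg]
        split_ifs
        exacts [le_rfl, hnonneg a b]
  have hsubP : ∀ a, |z a| ≤ ∑ b, P a b * |z b| := fun a =>
    (hsub a).trans <| Finset.sum_le_sum fun b _ => by
      refine mul_le_mul_of_nonneg_right ?_ (abs_nonneg _)
      split_ifs
      exacts [hnonneg a b, le_rfl]
  have hrowpow : ∀ m : ℕ, ∀ a, ∑ b, (P ^ m) a b = 1 := by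
    intro m
    induction m with
    | zero => intro a; simp [Matrix.one_apply]
    | succ m ih =>
      intro a
      simp_rw [pow_succ, Matrix.mul_apply]
      rw [Finset.sum_comm]
      simp_rw [← Finset.mul_sum, hrow, mul_one, ih]
  have hsubpow : ∀ m : ℕ, ∀ a, |z a| ≤ ∑ b, (P ^ m) a b * |z b| := by
    intro m
    induction m with
    | zero => intro a; simp [Matrix.one_apply]
    | succ m ih =>
      intro a
      calc |z a| ≤ ∑ c, P a c * |z c| := hsubP a
        _ ≤ ∑ c, P a c * ∑ b, (P ^ m) c b * |z b| :=
          Finset.sum_le_sum fun c _ => mul_le_mul_of_nonneg_left (ih c) (hnonneg a c)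
        _ = ∑ b, (P ^ (m + 1)) a b * |z b| := by
          simp_rw [pow_succ', Matrix.mul_apply, Finset.mul_sum, Finset.sum_mul]
          rw [Finset.sum_comm]
          simp_rw [mul_assoc]
  obtain ⟨a, -, ha⟩ := Finset.exists_max_image Finset.univ (fun b => |z b|) ⟨i, Finset.mem_univ i⟩
  have hconst : ∀ b, |z b| = |z a| := by
    have hsum : ∑ b, (P ^ k) a b * (|z a| - |z b|) = 0 := by
      refine le_antisymm ?_ (Finset.sum_nonneg fun b hb =>
        mul_nonneg (hpos a b).le (sub_nonneg.2 (ha b hb)))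
      simp_rw [mul_sub]
      rw [Finset.sum_sub_distrib, ← Finset.sum_mul, hrowpow, one_mul]
      linarith [hsubpow k a]
    intro b
    have hb := (Finset.sum_eq_zero_iff_of_nonneg fun b hb =>
      mul_nonneg (hpos a b).le (sub_nonneg.2 (ha b hb))).1 hsum b (Finset.mem_univ b)
    have := (mul_eq_zero.1 hb).resolve_left (hpos a b).ne'
    linarith
  obtain ⟨c, hc⟩ : ∃ c, 0 < P c i := by
    by_contra! h
    have hki := hpos i i
    obtain ⟨m, rfl⟩ : ∃ m, k = m + 1 := ⟨k - 1, by omega⟩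
    rw [pow_succ, Matrix.mul_apply,
      Finset.sum_eq_zero fun c _ => by rw [le_antisymm (h c) (hnonneg c i), mul_zero]] at hki
    exact lt_irrefl _ hki
  have hsumc : ∑ b, (if b = i then 0 else P c b) = 1 - P c i := by
    rw [← hrow c, ← Finset.sum_erase_eq_sub (Finset.mem_univ i), ← Finset.filter_ne',
      Finset.sum_filter]
    exact Finset.sum_congr rfl fun b _ => by by_cases hb : b = i <;> simp [hb]
  have hac := hsub c
  simp_rw [hconst] at hac
  rw [← Finset.sum_mul, hsumc] at hac
  have hza : |z a| = 0 := by
    refine le_antisymm ?_ (abs_nonneg _)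
    by_contra! h
    nlinarith [mul_pos hc h]
  funext b
  exact abs_eq_zero.1 ((hconst b).trans hza)


/-- If `P` is row-stochastic and regular and `X` solves
`(I - P) X = J - P * X_d`, then for every index `i` the `i`-th column of `X` is the
minimal-norm solution of `(I - P_i) x = e`. -/
theorem stmt_7 (n : ℕ) (hn : 0 < n) (P X : Matrix (Fin n) (Fin n) ℝ)
    (hnonneg : ∀ a b, 0 ≤ P a b) (hrow : ∀ a, ∑ b, P a b = 1)
    (hreg : ∃ k : ℕ, 0 < k ∧ ∀ a b, 0 < (P ^ k) a b)
    (hX : (1 - P) * X =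
        (Matrix.of fun _ _ => (1 : ℝ)) - P * Matrix.diagonal (fun i => X i i)) :
    ∀ i : Fin n,
      (1 - Matrix.of fun a b => if b = i then 0 else P a b).mulVec (fun j => X j i) =
        (fun _ => (1 : ℝ)) ∧
      ∀ y : Fin n → ℝ,
        (1 - Matrix.of fun a b => if b = i then 0 else P a b).mulVec y =
          (fun _ => (1 : ℝ)) →
        ∑ k, (X k i) ^ 2 ≤ ∑ k, (y k) ^ 2 := by
  intro i
  have hx : (1 - Matrix.of fun a b => if b = i then 0 else P a b).mulVec (fun j => X j i) =
      (fun _ => (1 : ℝ)) := by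
    funext a
    have h := congrFun (congrFun hX a) i
    rw [Matrix.sub_mul, one_mul, Matrix.sub_apply, Matrix.sub_apply, Matrix.mul_diagonal,
      Matrix.mul_apply, Matrix.of_apply] at h
    rw [Matrix.sub_mulVec, Matrix.one_mulVec]
    have hsplit : ∑ b, (if b = i then 0 else P a b) * X b i =
        ∑ b, P a b * X b i - P a i * X i i := by
      rw [← Finset.sum_erase_eq_sub (Finset.mem_univ i), ← Finset.filter_ne', Finset.sum_filter]
      exact Finset.sum_congr rfl fun b _ => by by_cases hb : b = i <;> simp [hb]
    simp only [Pi.sub_apply, Matrix.mulVec, dotProduct, Matrix.of_apply]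
    linarith
  refine ⟨hx, fun y hy => ?_⟩
  have hz : (fun j => X j i) - y = 0 := by
    refine eq_zero_of_eq_sum_deleted_column P hnonneg hrow hreg i _ fun a => ?_
    have h := congrFun (hx.trans hy.symm) a
    rw [← sub_eq_zero, ← Pi.sub_apply, ← Matrix.mulVec_sub, Matrix.sub_mulVec,
      Matrix.one_mulVec, Pi.sub_apply, sub_eq_zero] at h
    exact h
  rw [← sub_eq_zero.1 hz]
end
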